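/- For every positive integer h, every positive integer k, every positive integer ℓ, and every y = (y_1, …, y_ℓ) ∈ [0,1]^ℓ, the sum over all multi-indices ν ∈ {0, 1, …, k}^ℓ of the absolute value of the product basis satisfies ∑_{ν ∈ {0,…,k}^ℓ} ∏_{i=1}^{ℓ} |b^{(h)}_{ν_i,k}(y_i)| ≤ (2^h − 1)^ℓ. -/

import Mathlib

open Finset

/-- The Bernstein basis polynomial `b_{ν,k}(y) = C(k,ν) y^ν (1-y)^(k-ν)`. -/
noncomputable def bernsteinBasis (k ν : ℕ) (y : ℝ) : ℝ :=
  (k.choose ν : ℝ) * y ^ ν * (1 - y) ^ (k - ν)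

/-- The Bernstein operator: `B_k(f; y) = ∑_{ν=0}^k f(ν/k) b_{ν,k}(y)`. -/
noncomputable def bernsteinOp (k : ℕ) (f : ℝ → ℝ) (y : ℝ) : ℝ :=
  ∑ ν ∈ Finset.range (k + 1), f ((ν : ℝ) / (k : ℝ)) * bernsteinBasis k ν y

/-- The iterated Bernstein basis functions of order `h`:
`b^{(h)}_{ν,k}(y) = ∑_{i=1}^h C(h,i) (-1)^{i-1} B_k^{i-1}(b_{ν,k}; y)`. -/
noncomputable def iterBernsteinBasis (h k ν : ℕ) (y : ℝ) : ℝ :=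
  ∑ i ∈ Finset.Icc 1 h,
    (h.choose i : ℝ) * (-1 : ℝ) ^ (i - 1) * ((bernsteinOp k)^[i - 1] (bernsteinBasis k ν)) y

lemma bb_nonneg (k ν : ℕ) {y : ℝ} (hy : y ∈ Set.Icc (0 : ℝ) 1) : 0 ≤ bernsteinBasis k ν y := by
  have h1 : 0 ≤ y := hy.1
  have h2 : 0 ≤ 1 - y := by linarith [hy.2]
  unfold bernsteinBasis
  positivity

lemma bb_sum (k : ℕ) (y : ℝ) : ∑ ν ∈ Finset.range (k + 1), bernsteinBasis k ν y = 1 := by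
  have h := add_pow y (1 - y) k
  rw [add_sub_cancel, one_pow] at h
  rw [h]
  refine Finset.sum_congr rfl fun ν _ => ?_
  unfold bernsteinBasis
  ring

lemma node_mem {k ν : ℕ} (hν : ν ∈ Finset.range (k + 1)) :
    ((ν : ℝ) / (k : ℝ)) ∈ Set.Icc (0 : ℝ) 1 := by
  have h : ν ≤ k := by
    have := Finset.mem_range.1 hν
    omega
  exact ⟨by positivity, div_le_one_of_le₀ (by exact_mod_cast h) (by positivity)⟩

lemma iter_nonneg (k ν j : ℕ) : ∀ {y : ℝ}, y ∈ Set.Icc (0 : ℝ) 1 →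
    0 ≤ ((bernsteinOp k)^[j] (bernsteinBasis k ν)) y := by
  induction j with
  | zero => intro y hy; exact bb_nonneg k ν hy
  | succ j ih =>
    intro y hy
    rw [Function.iterate_succ_apply']
    exact Finset.sum_nonneg fun μ hμ => mul_nonneg (ih (node_mem hμ)) (bb_nonneg k μ hy)

lemma iter_sum (k j : ℕ) : ∀ y : ℝ,
    ∑ ν ∈ Finset.range (k + 1), ((bernsteinOp k)^[j] (bernsteinBasis k ν)) y = 1 := by
  induction j with
  | zero => intro y; exact bb_sum k y
  | succ j ih =>
    intro y
    simp only [Function.iterate_succ_apply']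
    unfold bernsteinOp
    rw [Finset.sum_comm]
    simp only [← Finset.sum_mul]
    rw [← bb_sum k y]
    refine Finset.sum_congr rfl fun μ _ => ?_
    have := ih ((μ : ℝ) / (k : ℝ))
    unfold bernsteinOp at this
    rw [this, one_mul]

lemma choose_sum (h : ℕ) : ∑ i ∈ Finset.Icc 1 h, (h.choose i : ℝ) = 2 ^ h - 1 := by
  have h1 : ∑ i ∈ Finset.range (h + 1), (h.choose i : ℝ) = 2 ^ h := by
    exact_mod_cast Nat.sum_range_choose h
  rw [Finset.range_eq_Ico, Finset.sum_eq_sum_Ico_succ_bot (by omega)] at h1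
  have h2 : Finset.Icc 1 h = Finset.Ico (0 + 1) (h + 1) := by
    ext x; simp only [Finset.mem_Icc, Finset.mem_Ico]; omega
  rw [h2]
  simp only [Nat.choose_zero_right, Nat.cast_one] at h1
  linarith

lemma univariate (h k : ℕ) {y : ℝ} (hy : y ∈ Set.Icc (0 : ℝ) 1) :
    ∑ ν : Fin (k + 1), |iterBernsteinBasis h k (ν : ℕ) y| ≤ 2 ^ h - 1 := by
  rw [Fin.sum_univ_eq_sum_range (fun ν => |iterBernsteinBasis h k ν y|) (k + 1)]
  calc ∑ ν ∈ Finset.range (k + 1), |iterBernsteinBasis h k ν y|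
      ≤ ∑ ν ∈ Finset.range (k + 1), ∑ i ∈ Finset.Icc 1 h,
          (h.choose i : ℝ) * ((bernsteinOp k)^[i - 1] (bernsteinBasis k ν)) y := by
        refine Finset.sum_le_sum fun ν _ => ?_
        refine (Finset.abs_sum_le_sum_abs _ _).trans (Finset.sum_le_sum fun i _ => ?_)
        rw [abs_mul, abs_mul, abs_pow, abs_neg, abs_one, one_pow, mul_one, Nat.abs_cast,
          abs_of_nonneg (iter_nonneg k ν (i - 1) hy)]
    _ = 2 ^ h - 1 := by
        rw [Finset.sum_comm]
        simp only [← Finset.mul_sum, iter_sum, mul_one]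
        exact choose_sum h

/-- For all positive integers `h, k, ℓ` and every `y ∈ [0,1]^ℓ`,
`∑_{ν ∈ {0,…,k}^ℓ} ∏_{i=1}^ℓ |b^{(h)}_{ν_i,k}(y_i)| ≤ (2^h - 1)^ℓ`. -/
theorem iterBernstein_multivariate_abs_sum_le
    (h k ℓ : ℕ) (hh : 0 < h) (hk : 0 < k) (hℓ : 0 < ℓ)
    (y : Fin ℓ → ℝ) (hy : ∀ i, y i ∈ Set.Icc (0 : ℝ) 1) :
    ∑ ν : Fin ℓ → Fin (k + 1), ∏ i : Fin ℓ, |iterBernsteinBasis h k (ν i : ℕ) (y i)|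
      ≤ (2 ^ h - 1 : ℝ) ^ ℓ := by
  rw [← Fintype.piFinset_univ, ← Finset.prod_univ_sum (fun _ => Finset.univ)
    (fun i (ν : Fin (k + 1)) => |iterBernsteinBasis h k (ν : ℕ) (y i)|)]
  refine (Finset.prod_le_prod (fun i _ => Finset.sum_nonneg fun _ _ => abs_nonneg _)
    (fun i _ => univariate h k (hy i))).trans ?_
  simp
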